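/- Let M be the 4×4 rational matrix with rows (1, 0, 0, 0), (0, 2, 3, 3), (0, 1, 1, 2), (0, 1, 3, 1). Then the set S(M) = {(t₁, t₂, s₁, s₂) ∈ ℂ⁴ : F(t₁, t₂, s₁, s₂; M) = 0, t₁ ≠ t₂, s₁ ≠ s₂} has exactly 40 elements, and at each of these 40 points the 4×4 Jacobian matrix of F(·; M) with respect to (t₁, t₂, s₁, s₂) is invertible (i.e., every such solution is nonsingular). -/

import Mathlib

open Matrix

noncomputable section

/-- `v(a) = (1, a, a², a³) ∈ ℂ⁴`. -/
def tcv (a : ℂ) : Fin 4 → ℂ := ![1, a, a ^ 2, a ^ 3]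

/-- `pᵢ(s; M)`, the `i`-th coordinate of `M·v(s)`. -/
def pc (M : Matrix (Fin 4) (Fin 4) ℂ) (i : Fin 4) (s : ℂ) : ℂ := M.mulVec (tcv s) i

/-- `f₁(t₁, t₂, s; M) = p₃(s; M) − (t₁ + t₂)p₂(s; M) + t₁t₂p₁(s; M)`. -/
def f₁ (M : Matrix (Fin 4) (Fin 4) ℂ) (t₁ t₂ s : ℂ) : ℂ :=
  pc M 2 s - (t₁ + t₂) * pc M 1 s + t₁ * t₂ * pc M 0 s

/-- `f₂(t₁, t₂, s; M) = p₄(s; M) − (t₁ + t₂)p₃(s; M) + t₁t₂p₂(s; M)`. -/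
def f₂ (M : Matrix (Fin 4) (Fin 4) ℂ) (t₁ t₂ s : ℂ) : ℂ :=
  pc M 3 s - (t₁ + t₂) * pc M 2 s + t₁ * t₂ * pc M 1 s

/-- The square polynomial system `F(·; M)` viewed as a map `ℂ⁴ → ℂ⁴`, with the
variables ordered `(t₁, t₂, s₁, s₂)`. -/
def Fmap (M : Matrix (Fin 4) (Fin 4) ℂ) (x : Fin 4 → ℂ) : Fin 4 → ℂ :=
  ![f₁ M (x 0) (x 1) (x 2), f₁ M (x 0) (x 1) (x 3),
    f₂ M (x 0) (x 1) (x 2), f₂ M (x 0) (x 1) (x 3)]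

/-- `S(M)`: solutions of `F(·; M) = 0` with `t₁ ≠ t₂` and `s₁ ≠ s₂`. -/
def Ssol (M : Matrix (Fin 4) (Fin 4) ℂ) : Set (Fin 4 → ℂ) :=
  {x | Fmap M x = 0 ∧ x 0 ≠ x 1 ∧ x 2 ≠ x 3}

/-- The 4×4 Jacobian matrix of `F(·; M)` with respect to `(t₁, t₂, s₁, s₂)`. -/
def Jac (M : Matrix (Fin 4) (Fin 4) ℂ) (x : Fin 4 → ℂ) : Matrix (Fin 4) (Fin 4) ℂ :=
  fun i j => deriv (fun z => Fmap M (Function.update x j z) i) (x j)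

/-- A real matrix viewed as a complex matrix. -/
def cm (M : Matrix (Fin 4) (Fin 4) ℝ) : Matrix (Fin 4) (Fin 4) ℂ :=
  M.map Complex.ofReal

/-- The specific rational matrix from the proof of Proposition 2.1. -/
def M₁₀ : Matrix (Fin 4) (Fin 4) ℚ :=
  !![1, 0, 0, 0;
     0, 2, 3, 3;
     0, 1, 1, 2;
     0, 1, 3, 1]

/-! ### The system in the symmetric functions of `t₁, t₂` and of `s₁, s₂` -/

/-- With `t = t₁ + t₂`, `u = t₁ t₂`, `s = s₁ + s₂`, `p = s₁ s₂`: the remainders of the cubics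
`f₁` and `f₂` (in the last variable) on division by `z² - s z + p` vanish. -/
def RemaindersVanish (t u s p : ℂ) : Prop :=
  (2 - 3 * t) * (s ^ 2 - p) + (1 - 3 * t) * s + (1 - 2 * t) = 0 ∧
  u - (1 - 3 * t) * p - (2 - 3 * t) * s * p = 0 ∧
  (1 - 2 * t + 3 * u) * (s ^ 2 - p) + (3 - t + 3 * u) * s + (1 - t + 2 * u) = 0 ∧
  p * ((1 - 2 * t + 3 * u) * s + (3 - t + 3 * u)) = 0

lemma pc_M₁₀ (z : ℂ) :
    pc (M₁₀.map (fun q => (q : ℂ))) 0 z = 1 ∧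
    pc (M₁₀.map (fun q => (q : ℂ))) 1 z = 2 * z + 3 * z ^ 2 + 3 * z ^ 3 ∧
    pc (M₁₀.map (fun q => (q : ℂ))) 2 z = z + z ^ 2 + 2 * z ^ 3 ∧
    pc (M₁₀.map (fun q => (q : ℂ))) 3 z = z + 3 * z ^ 2 + z ^ 3 := by
  simp [pc, tcv, mulVec, dotProduct, Fin.sum_univ_four, M₁₀]

lemma f₁_M₁₀ (t₁ t₂ z : ℂ) : f₁ (M₁₀.map (fun q => (q : ℂ))) t₁ t₂ z =
    (z + z ^ 2 + 2 * z ^ 3) - (t₁ + t₂) * (2 * z + 3 * z ^ 2 + 3 * z ^ 3) + t₁ * t₂ := by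
  obtain ⟨h0, h1, h2, -⟩ := pc_M₁₀ z
  rw [f₁, h0, h1, h2, mul_one]

lemma f₂_M₁₀ (t₁ t₂ z : ℂ) : f₂ (M₁₀.map (fun q => (q : ℂ))) t₁ t₂ z =
    (z + 3 * z ^ 2 + z ^ 3) - (t₁ + t₂) * (z + z ^ 2 + 2 * z ^ 3)
      + t₁ * t₂ * (2 * z + 3 * z ^ 2 + 3 * z ^ 3) := by
  obtain ⟨-, h1, h2, h3⟩ := pc_M₁₀ z
  rw [f₂, h1, h2, h3]

lemma mem_Ssol_iff (x : Fin 4 → ℂ) : x ∈ Ssol (M₁₀.map (fun q => (q : ℂ))) ↔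
    RemaindersVanish (x 0 + x 1) (x 0 * x 1) (x 2 + x 3) (x 2 * x 3) ∧ x 0 ≠ x 1 ∧ x 2 ≠ x 3 := by
  simp only [Ssol, Set.mem_ofPred_eq, and_congr_left_iff]
  rintro ⟨-, hs⟩
  have hs' : x 2 - x 3 ≠ 0 := sub_ne_zero.2 hs
  simp only [Fmap, f₁_M₁₀, f₂_M₁₀, funext_iff, Fin.forall_fin_succ, RemaindersVanish]
  simp only [cons_val_zero, cons_val_succ, Pi.zero_apply, IsEmpty.forall_iff, and_true]
  constructor
  · rintro ⟨h1, h2, h3, h4⟩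
    refine ⟨mul_left_cancel₀ hs' ?_, mul_left_cancel₀ hs' ?_, mul_left_cancel₀ hs' ?_,
      mul_left_cancel₀ hs' ?_⟩
    · linear_combination h1 - h2
    · linear_combination x 2 * h2 - x 3 * h1
    · linear_combination h3 - h4
    · linear_combination x 3 * h3 - x 2 * h4
  · rintro ⟨h1, h2, h3, h4⟩
    refine ⟨?_, ?_, ?_, ?_⟩
    · linear_combination x 2 * h1 + h2
    · linear_combination x 3 * h1 + h2
    · linear_combination x 2 * h3 - h4
    · linear_combination x 3 * h3 - h4

/-! ### The Jacobian determinant -/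

/-- Constant term of the first component of the reduced column vector of the Jacobian. -/
def jacConstFst (t s p u : ℂ) : ℂ :=
  (-p - 2 * s * p) * (1 - 3 * t + (2 - 3 * t) * s)
    - (1 + s + 2 * (s ^ 2 - p)) * (2 - 3 * t) * p
    - (-3 * p - 3 * s * p) * (3 - t + 3 * u + (1 - 2 * t + 3 * u) * s)
    + (2 + 3 * s + 3 * (s ^ 2 - p)) * (1 - 2 * t + 3 * u) * p

/-- Linear coefficient of the first component of the reduced column vector of the Jacobian. -/
def jacLinFst (t s p u : ℂ) : ℂ :=
  (1 + s + 2 * (s ^ 2 - p)) * (1 - 3 * t + (2 - 3 * t) * s)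
    + (-p - 2 * s * p) * (2 - 3 * t) + (1 + s + 2 * (s ^ 2 - p)) * (2 - 3 * t) * s
    - (2 + 3 * s + 3 * (s ^ 2 - p)) * (3 - t + 3 * u + (1 - 2 * t + 3 * u) * s)
    - (-3 * p - 3 * s * p) * (1 - 2 * t + 3 * u)
    - (2 + 3 * s + 3 * (s ^ 2 - p)) * (1 - 2 * t + 3 * u) * s

/-- Constant term of the second component of the reduced column vector of the Jacobian. -/
def jacConstSnd (t s p u : ℂ) : ℂ :=
  3 - t + 3 * u + (1 - 2 * t + 3 * u) * s
    - (-3 * p - 3 * s * p) * (1 - 3 * t + (2 - 3 * t) * s)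
    + (2 + 3 * s + 3 * (s ^ 2 - p)) * (2 - 3 * t) * p

/-- Linear coefficient of the second component of the reduced column vector of the Jacobian. -/
def jacLinSnd (t s p u : ℂ) : ℂ :=
  1 - 2 * t + 3 * u
    - (2 + 3 * s + 3 * (s ^ 2 - p)) * (1 - 3 * t + (2 - 3 * t) * s)
    - (-3 * p - 3 * s * p) * (2 - 3 * t) - (2 + 3 * s + 3 * (s ^ 2 - p)) * (2 - 3 * t) * s

/-- The Jacobian determinant divided by its Vandermonde-type factors, in symmetric coordinates. -/
def jacFactor (t u s p : ℂ) : ℂ :=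
  jacConstFst t s p u * jacLinSnd t s p u - jacConstSnd t s p u * jacLinFst t s p u

lemma deriv_cubic (a b c d z : ℂ) :
    deriv (fun w : ℂ => a + b * w + c * w ^ 2 + d * w ^ 3) z = b + 2 * c * z + 3 * d * z ^ 2 := by
  have h : HasDerivAt (fun w : ℂ => a + b * w + c * w ^ 2 + d * w ^ 3)
      (b * 1 + c * (((2 : ℕ) : ℂ) * z ^ (2 - 1)) + d * (((3 : ℕ) : ℂ) * z ^ (3 - 1))) z :=
    ((((hasDerivAt_id z).const_mul b).const_add a).add ((hasDerivAt_pow 2 z).const_mul c)).add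
      ((hasDerivAt_pow 3 z).const_mul d)
  rw [h.deriv]
  push_cast
  ring

lemma deriv_eq_of_cubic {f : ℂ → ℂ} (a b c d : ℂ)
    (h : ∀ w, f w = a + b * w + c * w ^ 2 + d * w ^ 3) (z : ℂ) :
    deriv f z = b + 2 * c * z + 3 * d * z ^ 2 := by
  rw [funext h, deriv_cubic]

lemma det_of_disjoint_columns (a b c d e f g h k l m n : ℂ) :
    det !![a, b, k, 0; c, d, 0, l; e, f, m, 0; g, h, 0, n] =
      k * l * (e * h - f * g) - k * n * (e * d - f * c)
        - m * l * (a * h - b * g) + m * n * (a * d - b * c) := by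
  simp [det_succ_row_zero, Fin.sum_univ_succ, Fin.succAbove]
  ring

lemma Jac_M₁₀ (x : Fin 4 → ℂ) : Jac (M₁₀.map (fun q => (q : ℂ))) x =
    !![x 1 - (2 * x 2 + 3 * x 2 ^ 2 + 3 * x 2 ^ 3), x 0 - (2 * x 2 + 3 * x 2 ^ 2 + 3 * x 2 ^ 3),
        1 + 2 * x 2 + 6 * x 2 ^ 2 - (x 0 + x 1) * (2 + 6 * x 2 + 9 * x 2 ^ 2), 0;
      x 1 - (2 * x 3 + 3 * x 3 ^ 2 + 3 * x 3 ^ 3), x 0 - (2 * x 3 + 3 * x 3 ^ 2 + 3 * x 3 ^ 3), 0,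
        1 + 2 * x 3 + 6 * x 3 ^ 2 - (x 0 + x 1) * (2 + 6 * x 3 + 9 * x 3 ^ 2);
      x 1 * (2 * x 2 + 3 * x 2 ^ 2 + 3 * x 2 ^ 3) - (x 2 + x 2 ^ 2 + 2 * x 2 ^ 3),
        x 0 * (2 * x 2 + 3 * x 2 ^ 2 + 3 * x 2 ^ 3) - (x 2 + x 2 ^ 2 + 2 * x 2 ^ 3),
        1 + 6 * x 2 + 3 * x 2 ^ 2 - (x 0 + x 1) * (1 + 2 * x 2 + 6 * x 2 ^ 2)
          + x 0 * x 1 * (2 + 6 * x 2 + 9 * x 2 ^ 2), 0;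
      x 1 * (2 * x 3 + 3 * x 3 ^ 2 + 3 * x 3 ^ 3) - (x 3 + x 3 ^ 2 + 2 * x 3 ^ 3),
        x 0 * (2 * x 3 + 3 * x 3 ^ 2 + 3 * x 3 ^ 3) - (x 3 + x 3 ^ 2 + 2 * x 3 ^ 3), 0,
        1 + 6 * x 3 + 3 * x 3 ^ 2 - (x 0 + x 1) * (1 + 2 * x 3 + 6 * x 3 ^ 2)
          + x 0 * x 1 * (2 + 6 * x 3 + 9 * x 3 ^ 2)] := by
  have hlin (f : ℂ → ℂ) (z b : ℂ) (h : ∀ w, f w = f 0 + b * w) : deriv f z = b := by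
    rw [deriv_eq_of_cubic (f 0) b 0 0 (fun w => by rw [h w]; ring)]
    ring
  have hcub (f : ℂ → ℂ) (z b c d e : ℂ) (h : ∀ w, f w = f 0 + b * w + c * w ^ 2 + d * w ^ 3)
      (he : e = b + 2 * c * z + 3 * d * z ^ 2) : deriv f z = e := by
    rw [deriv_eq_of_cubic (f 0) b c d h, he]
  ext i j
  unfold Jac
  fin_cases j
  · fin_cases i <;> refine hlin _ _ _ fun w => ?_ <;>
      simp [Fmap, f₁_M₁₀, f₂_M₁₀] <;> ring
  · fin_cases i <;> refine hlin _ _ _ fun w => ?_ <;>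
      simp [Fmap, f₁_M₁₀, f₂_M₁₀] <;> ring
  all_goals
    fin_cases i <;> first
      | refine hlin _ _ _ fun w => ?_
        simp [Fmap, f₁_M₁₀, f₂_M₁₀]
        done
      | refine hcub _ _ (1 - 2 * (x 0 + x 1)) (1 - 3 * (x 0 + x 1)) (2 - 3 * (x 0 + x 1)) _
          (fun w => ?_) ?_ <;>
          simp [Fmap, f₁_M₁₀, f₂_M₁₀] <;> ring1
      | refine hcub _ _ (1 - (x 0 + x 1) + 2 * (x 0 * x 1)) (3 - (x 0 + x 1) + 3 * (x 0 * x 1))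
          (1 - 2 * (x 0 + x 1) + 3 * (x 0 * x 1)) _ (fun w => ?_) ?_ <;>
          simp [Fmap, f₁_M₁₀, f₂_M₁₀] <;> ring1

lemma det_Jac_M₁₀ (x : Fin 4 → ℂ)
    (hx : RemaindersVanish (x 0 + x 1) (x 0 * x 1) (x 2 + x 3) (x 2 * x 3)) :
    det (Jac (M₁₀.map (fun q => (q : ℂ))) x) =
      (x 0 - x 1) * (x 2 - x 3) ^ 3 *
        jacFactor (x 0 + x 1) (x 0 * x 1) (x 2 + x 3) (x 2 * x 3) := by
  obtain ⟨h1, -, h3, -⟩ := hx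
  rw [Jac_M₁₀, det_of_disjoint_columns]
  have d1 : 1 + 2 * x 2 + 6 * x 2 ^ 2 - (x 0 + x 1) * (2 + 6 * x 2 + 9 * x 2 ^ 2) =
      (x 2 - x 3) * ((2 - 3 * (x 0 + x 1)) * x 2 +
        (1 - 3 * (x 0 + x 1) + (2 - 3 * (x 0 + x 1)) * (x 2 + x 3))) := by
    linear_combination h1
  have d2 : 1 + 2 * x 3 + 6 * x 3 ^ 2 - (x 0 + x 1) * (2 + 6 * x 3 + 9 * x 3 ^ 2) =
      (x 3 - x 2) * ((2 - 3 * (x 0 + x 1)) * x 3 +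
        (1 - 3 * (x 0 + x 1) + (2 - 3 * (x 0 + x 1)) * (x 2 + x 3))) := by
    linear_combination h1
  have d3 : 1 + 6 * x 2 + 3 * x 2 ^ 2 - (x 0 + x 1) * (1 + 2 * x 2 + 6 * x 2 ^ 2)
        + x 0 * x 1 * (2 + 6 * x 2 + 9 * x 2 ^ 2) =
      (x 2 - x 3) * ((1 - 2 * (x 0 + x 1) + 3 * (x 0 * x 1)) * x 2 +
        (3 - (x 0 + x 1) + 3 * (x 0 * x 1) +
          (1 - 2 * (x 0 + x 1) + 3 * (x 0 * x 1)) * (x 2 + x 3))) := by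
    linear_combination h3
  have d4 : 1 + 6 * x 3 + 3 * x 3 ^ 2 - (x 0 + x 1) * (1 + 2 * x 3 + 6 * x 3 ^ 2)
        + x 0 * x 1 * (2 + 6 * x 3 + 9 * x 3 ^ 2) =
      (x 3 - x 2) * ((1 - 2 * (x 0 + x 1) + 3 * (x 0 * x 1)) * x 3 +
        (3 - (x 0 + x 1) + 3 * (x 0 * x 1) +
          (1 - 2 * (x 0 + x 1) + 3 * (x 0 * x 1)) * (x 2 + x 3))) := by
    linear_combination h3
  rw [d1, d2, d3, d4]
  simp only [jacFactor, jacConstFst, jacConstSnd, jacLinFst, jacLinSnd]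
  ring

/-! ### Solutions with `p = 0`, indexed by the roots of a quartic -/

/-- The value of `t₁ + t₂` at the solutions with `s₁ s₂ = 0`, as a function of `x = s₁ + s₂`. -/
def quarticT (x : ℂ) : ℂ := (-3 * x ^ 3 + 25 * x ^ 2 + 20 * x + 5) / 4

lemma remaindersVanish_zero_iff (t u x : ℂ) : RemaindersVanish t u x 0 ↔
    x ^ 4 - 8 * x ^ 3 - 9 * x ^ 2 - 7 * x - 1 = 0 ∧ t = quarticT x ∧ u = 0 := by
  constructor
  · rintro ⟨h1, h2, h3, -⟩
    have hu : u = 0 := by linear_combination h2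
    subst hu
    have hP : x ^ 4 - 8 * x ^ 3 - 9 * x ^ 2 - 7 * x - 1 = 0 := by
      linear_combination (2 * x ^ 2 + x + 1) * h1 - (3 * x ^ 2 + 3 * x + 2) * h3
    refine ⟨hP, ?_, rfl⟩
    unfold quarticT
    linear_combination -((-9 * x ^ 3 + 87 * x ^ 2 - 48 * x - 1) / 16) * h1 + ((-18 * x + 21) / 16 -
        t * (-27 * x + 18) / 16) * hP
  · rintro ⟨h, rfl, rfl⟩
    unfold quarticT
    refine ⟨?_, by ring, ?_, by ring⟩
    · linear_combination (9 * x + 6) / 4 * h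
    · linear_combination (6 * x + 1) / 4 * h

lemma nondegenerate_of_quartic {x : ℂ} (h : x ^ 4 - 8 * x ^ 3 - 9 * x ^ 2 - 7 * x - 1 = 0) :
    quarticT x ^ 2 - 4 * 0 ≠ 0 ∧ x ^ 2 - 4 * 0 ≠ 0 ∧ jacFactor (quarticT x) 0 x 0 ≠ 0 := by
  unfold quarticT
  refine ⟨fun h0 => one_ne_zero (α := ℂ) ?_, fun h0 => one_ne_zero (α := ℂ) ?_,
    fun h0 => one_ne_zero (α := ℂ) ?_⟩
  · linear_combination (-79 * x ^ 3 + 650 * x ^ 2 + 592 * x + 461) / 121 * h0 - (-711 * x ^ 5 +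
      12012 * x ^ 4 - 42370 * x ^ 3 - 68860 * x ^ 2 - 39877 * x - 9589) / 1936 * h
  · linear_combination (-7 * x ^ 3 + 57 * x ^ 2 + 55 * x + 40) * h0 - (-7 * x + 1) * h
  · simp only [jacFactor, jacConstFst, jacConstSnd, jacLinFst, jacLinSnd] at h0
    linear_combination (-1795 * x ^ 3 + 14334 * x ^ 2 + 16875 * x + 11254) / 98541 * h0 - (-96930 *
        x ^ 8 + 1501011 * x ^ 7 - 3418530 * x ^ 6 - 18244352 * x ^ 5 - 17558361 * x ^ 4 + 1078396 *
        x ^ 3 + 10518647 * x ^ 2 + 3802857 * x - 392794) / 1576656 * h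

/-! ### Solutions with `p ≠ 0`, indexed by the roots of a sextic -/

/-- The value of `s₁ s₂` at the solutions with `s₁ s₂ ≠ 0`, as a function of `x = s₁ + s₂`. -/
def sexticP (x : ℂ) : ℂ :=
  (-1185000 * x ^ 5 + 5475076 * x ^ 4 + 18038481 * x ^ 3 + 53385285 * x ^ 2 + 42949157 * x +
      24563521) / 32563790

/-- The value of `t₁ + t₂` at the solutions with `s₁ s₂ ≠ 0`, as a function of `x = s₁ + s₂`. -/
def sexticT (x : ℂ) : ℂ :=
  (-1632156906 * x ^ 5 + 8304200879 * x ^ 4 + 25967939460 * x ^ 3 + 28479868688 * x ^ 2 +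
      18924883664 * x + 4286688375) / 618712010

/-- The value of `t₁ t₂` at the solutions with `s₁ s₂ ≠ 0`, as a function of `x = s₁ + s₂`. -/
def sexticU (x : ℂ) : ℂ :=
  (143152740 * x ^ 5 - 800769216 * x ^ 4 - 1850276621 * x ^ 3 - 1687111055 * x ^ 2 - 1054445657 * x
      - 288687251) / 88387430

lemma sexticP_ne_zero {x : ℂ}
    (h : 237 * x ^ 6 - 1088 * x ^ 5 - 4381 * x ^ 4 - 5942 * x ^ 3 - 4683 * x ^ 2 - 2082 * x - 321 =
        0) :
    sexticP x ≠ 0 := by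
  unfold sexticP
  refine fun h0 => one_ne_zero (α := ℂ) ?_
  linear_combination (-219475509 * x ^ 5 + 784987582 * x ^ 4 + 5427409621 * x ^ 3 + 7834315467 * x ^
      2 + 4230788538 * x + 1266595311) / 293074110 * h0 - (1097377545000 * x ^ 4 - 3957420285332 * x
      ^ 3 - 23589370359649 * x ^ 2 - 57413664702863 * x - 67191391737611) / 9543603772476900 * h

lemma remaindersVanish_of_sextic {x : ℂ}
    (h : 237 * x ^ 6 - 1088 * x ^ 5 - 4381 * x ^ 4 - 5942 * x ^ 3 - 4683 * x ^ 2 - 2082 * x - 321 =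
        0) :
    RemaindersVanish (sexticT x) (sexticU x) x (sexticP x) := by
  unfold sexticT sexticU sexticP
  refine ⟨?_, ?_, ?_, ?_⟩
  · linear_combination (24482353590000 * x ^ 4 - 125287690851264 * x ^ 3 - 309275707033794 * x ^ 2 -
      283485805695897 * x - 82426656524505) / 20147607964117900 * h
  · linear_combination (24482353590000 * x ^ 5 - 100805337261264 * x ^ 4 - 434563397885058 * x ^ 3 -
      1265536382780751 * x ^ 2 - 1376990885828172 * x - 731730458529685) / 20147607964117900 * h
  · linear_combination (31352606760000 * x ^ 4 - 168050813630096 * x ^ 3 - 350972004282968 * x ^ 2 -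
      303012847336150 * x - 290515671254001) / 20147607964117900 * h
  · linear_combination (-7838151690000 * x ^ 5 + 36214747850024 * x ^ 4 + 119315063573994 * x ^ 3 +
      353115579615090 * x ^ 2 + 284086082298418 * x + 162474771002954) / 5036901991029475 * h

lemma eq_of_remaindersVanish {t u x p : ℂ} (hp : p ≠ 0) (h : RemaindersVanish t u x p) :
    237 * x ^ 6 - 1088 * x ^ 5 - 4381 * x ^ 4 - 5942 * x ^ 3 - 4683 * x ^ 2 - 2082 * x - 321 = 0 ∧
      t = sexticT x ∧ u = sexticU x ∧ p = sexticP x := by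
  obtain ⟨h1, h2, h3, h4⟩ := h
  replace h4 : (1 - 2 * t + 3 * u) * x + (3 - t + 3 * u) = 0 := (mul_eq_zero.1 h4).resolve_left hp
  replace h3 : (1 - 2 * t + 3 * u) * p - (1 - t + 2 * u) = 0 := by linear_combination x * h4 - h3
  have ht : t * (x + 3 * p - 1) = 3 - x - 6 * p := by
    linear_combination (3 * p - 2) * h4 - 3 * (x + 1) * h3
  have hu : u * (x + 3 * p - 1) = 2 - x - 5 * p := by
    linear_combination (2 * p - 1) * h4 - (2 * x + 1) * h3
  have g1 : -24 * p ^ 2 + (24 * x ^ 2 + 16 * x + 26) * p + (5 * x ^ 3 - 7 * x ^ 2 - 7 * x - 7)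
      = 0 := by
    linear_combination (x + 3 * p - 1) * h1 + (3 * (x ^ 2 - p) + 3 * x + 2) * ht
  have g2 : -(24 * x + 21) * p ^ 2 + (-5 * x ^ 2 + 7 * x + 5) * p + (2 - x) = 0 := by
    linear_combination (x + 3 * p - 1) * h2 - hu - (3 * p + 3 * x * p) * ht
  have hL : (-576 * x ^ 3 - 1008 * x ^ 2 - 792 * x - 426) * p
      + (-120 * x ^ 4 + 63 * x ^ 3 + 315 * x ^ 2 + 291 * x + 195) = 0 := by
    linear_combination -(24 * x + 21) * g1 + 24 * g2
  have hP : 237 * x ^ 6 - 1088 * x ^ 5 - 4381 * x ^ 4 - 5942 * x ^ 3 - 4683 * x ^ 2 - 2082 * x - 321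
      = 0 := by
    linear_combination ((4608 * x ^ 4 + 12096 * x ^ 3 + 13392 * x ^ 2 + 8952 * x + 2982) * p + (969
        * x ^ 3 + 1715 * x ^ 2 + 1283 * x + 655)) * g1 + ((-4608 * x ^ 3 - 8064 * x ^ 2 - 6336 * x -
        3408) * p + (4608 * x ^ 5 + 12096 * x ^ 4 + 16200 * x ^ 3 + 13848 * x ^ 2 + 6808 * x +
        2132)) * g2
  have hp' : p = sexticP x := by
    unfold sexticP
    linear_combination (-12842837639424 * x ^ 5 + 60533131575744 * x ^ 4 + 213413046302688 * x ^ 3 +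
        406462880793912 * x ^ 2 + 313482595657092 * x + 54246849658873) / 1590600628746150 * hL +
        (-p * (5202162081792 * x ^ 2 + 8465689608192 * x + 12824381403648) / 265100104791025 -
        (1083783767040 * x ^ 3 - 701922734976 * x ^ 2 - 1360958957088 * x - 6115242831120) /
        265100104791025) * hP
  refine ⟨hP, ?_, ?_, hp'⟩
  · rw [hp'] at ht
    unfold sexticP at ht
    unfold sexticT
    linear_combination (-6270521352 * x ^ 5 + 33424555294 * x ^ 4 + 90791687961 * x ^ 3 +
        92389069531 * x ^ 2 + 59993126125 * x + 14017097011) / 618712010 * ht + ((-94057820280000 *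
        x ^ 4 + 504152440890288 * x ^ 3 + 1052916012848904 * x ^ 2 + 3493746649565970 * x +
        1302331698354923) / 10073803982058950 + t * (-94057820280000 * x ^ 4 + 504152440890288 * x ^
        3 + 1052916012848904 * x ^ 2 + 3493746649565970 * x + 1733116382947843) / 20147607964117900)
        * hP
  · rw [hp'] at hu
    unfold sexticP at hu
    unfold sexticU
    linear_combination (-6270521352 * x ^ 5 + 33424555294 * x ^ 4 + 90791687961 * x ^ 3 +
        92389069531 * x ^ 2 + 59993126125 * x + 14017097011) / 618712010 * hu + ((-31352606760000 *
        x ^ 4 + 168050813630096 * x ^ 3 + 350972004282968 * x ^ 2 + 1164582216521990 * x +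
        462829545091169) / 4029521592823580 + u * (-94057820280000 * x ^ 4 + 504152440890288 * x ^ 3
        + 1052916012848904 * x ^ 2 + 3493746649565970 * x + 1733116382947843) / 20147607964117900) *
        hP

lemma nondegenerate_of_sextic {x : ℂ}
    (h : 237 * x ^ 6 - 1088 * x ^ 5 - 4381 * x ^ 4 - 5942 * x ^ 3 - 4683 * x ^ 2 - 2082 * x - 321 =
        0) :
    sexticT x ^ 2 - 4 * sexticU x ≠ 0 ∧ x ^ 2 - 4 * sexticP x ≠ 0 ∧
      jacFactor (sexticT x) (sexticU x) x (sexticP x) ≠ 0 := by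
  refine ⟨fun h0 => one_ne_zero (α := ℂ) ?_, fun h0 => one_ne_zero (α := ℂ) ?_,
    fun h0 => one_ne_zero (α := ℂ) ?_⟩
  · unfold sexticT sexticU at h0
    linear_combination (-69611991234 * x ^ 5 + 313667374981 * x ^ 4 + 1356189999760 * x ^ 3 +
        1672840759042 * x ^ 2 + 1128437487346 * x + 614148148625) / 2175326299580 * h0 -
        (-782455278573199636566302952 * x ^ 9 + 7895724896958203025903439356 * x ^ 8 +
        5793590054286554751410007202 * x ^ 7 - 103674147735870599835802699315 * x ^ 6 -
        326544221242700839485123248246 * x ^ 5 - 504091000085381453001607882949 * x ^ 4 -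
        512600007940640654281866997556 * x ^ 3 - 349358503433538643491880420135 * x ^ 2 -
        154287640357343291899303534280 * x - 42131317947252493396479157625) /
        832724808081489447690969158000 * h
  · unfold sexticP at h0
    linear_combination (12267387902430 * x ^ 5 - 26675335193853 * x ^ 4 - 412139971532728 * x ^ 3 -
        593458241051085 * x ^ 2 - 240507053427506 * x - 127702980563423) / 189501345042415 * h0 -
        (122673879024300000 * x ^ 4 - 270384498757649280 * x ^ 3 - 3729902596400913412 * x ^ 2 -
        6560994284333815312 * x - 9932176596028329621) / 3085441002339371576425 * h
  · have v00 : jacConstFst (sexticT x) x (sexticP x) (sexticU x) =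
        (-2354832 * x ^ 5 - 241022988 * x ^ 4 + 1682073304 * x ^ 3 + 2111730141 * x ^ 2 + 2599606606
            * x + 786926939) / 309356005 := by
      unfold jacConstFst sexticT sexticU sexticP
      linear_combination (-7633619860500000000 * x ^ 9 + 78196719490941600000 * x ^ 8 -
          8602908209774815680 * x ^ 7 - 801152687500667830368 * x ^ 6 - 2392158859684245140436 * x ^
          5 - 884616523139793560832 * x ^ 4 + 7858020946362100177045 * x ^ 3 +
          17715811871194915437151 * x ^ 2 + 13058744505866226528489 * x + 6247353415282180331131) /
          93726067820837547263000 * h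
    have v01 : jacConstSnd (sexticT x) x (sexticP x) (sexticU x) =
        (-14906352 * x ^ 5 - 108941848 * x ^ 4 + 1388952414 * x ^ 3 + 1978107636 * x ^ 2 - 87021974
            * x - 807755776) / 309356005 := by
      unfold jacConstSnd sexticT sexticU sexticP
      linear_combination (-87034767012450000000 * x ^ 9 + 847525980668612040000 * x ^ 8 +
          366469660885102751808 * x ^ 7 - 9322853247918303639984 * x ^ 6 - 30554855192373352964298 *
          x ^ 5 - 28265130379256549355585 * x ^ 4 + 67140696916678849054074 * x ^ 3 +
          185633867380433191955226 * x ^ 2 + 174493182218153445097224 * x +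
          106613998412986606127735) / 656082474745862830841000 * h
    have v10 : jacLinFst (sexticT x) x (sexticP x) (sexticU x) =
        (819504762 * x ^ 5 - 3429509362 * x ^ 4 - 16843534669 * x ^ 3 - 23519542481 * x ^ 2 -
            16275207301 * x - 4318155364) / 309356005 := by
      unfold jacLinFst sexticT sexticU sexticP
      linear_combination (-19325619900000 * x ^ 5 + 95792135909040 * x ^ 4 + 258606844959924 * x ^ 3
          + 447726908124000 * x ^ 2 + 192634516223013 * x + 149609452162028) / 2878229709159700 * h
    have v11 : jacLinSnd (sexticT x) x (sexticP x) (sexticU x) =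
        (4638364446 * x ^ 5 - 25120354415 * x ^ 4 - 64823748501 * x ^ 3 - 64837268858 * x ^ 2 -
            41686954471 * x - 9730408636) / 309356005 := by
      unfold jacLinSnd sexticT sexticU sexticP
      linear_combination (-220341182310000 * x ^ 5 + 980695096121376 * x ^ 4 + 3535207508411730 * x
          ^ 3 + 6425351103619017 * x ^ 2 + 5475990013719237 * x + 2442471345162570) /
          20147607964117900 * h
    rw [jacFactor, v00, v01, v10, v11] at h0
    linear_combination (27926738333680449 * x ^ 5 - 59168458379453294 * x ^ 4 - 909019960912094768 *
        x ^ 3 - 1558143403856068452 * x ^ 2 - 1292139713201893467 * x - 602699670276034668) /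
        4265996780603674620 * h0 - (1145790477734816973925231488 * x ^ 9 -
        901427734424374517637455113320 * x ^ 8 + 8611476616142187548265244869848 * x ^ 7 +
        15347952098474108095775001937006 * x ^ 6 - 160855680688947700258354791729801 * x ^ 5 -
        372534657883862314180090102032691 * x ^ 4 - 613836241173424348125075755329844 * x ^ 3 -
        597233351097306988895746980367935 * x ^ 2 - 389950505340300037680297758665008 * x -
        147773846240009330694247662659268) / 3069629668278282732928923104203500 * h

/-! ### Counting -/

open Polynomial in
lemma exists_finset_roots {P : ℂ[X]} (h : ∀ x, P.eval x = 0 → P.derivative.eval x ≠ 0) :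
    ∃ R : Finset ℂ, R.card = P.natDegree ∧ ∀ x, x ∈ R ↔ P.eval x = 0 := by
  classical
  have hP : P ≠ 0 := by
    rintro rfl
    simpa using h 0
  have hnd : P.roots.Nodup := by
    rw [Multiset.nodup_iff_count_le_one]
    intro a
    rw [count_roots]
    by_contra! hlt
    obtain ⟨h0, h1⟩ := (one_lt_rootMultiplicity_iff_isRoot hP).1 hlt
    exact h a h0 h1
  refine ⟨P.roots.toFinset, ?_, fun x => by simp [hP]⟩
  rw [Multiset.toFinset_card_of_nodup hnd]
  exact (IsAlgClosed.splits P).natDegree_eq_card_roots.symm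

open Polynomial in
lemma exists_quartic_roots : ∃ R : Finset ℂ, R.card = 4 ∧
    ∀ x, x ∈ R ↔ x ^ 4 - 8 * x ^ 3 - 9 * x ^ 2 - 7 * x - 1 = 0 := by
  obtain ⟨R, hR, h⟩ := exists_finset_roots (P := X ^ 4 - 8 * X ^ 3 - 9 * X ^ 2 - 7 * X - 1)
    fun x h h0 => one_ne_zero (α := ℂ) <| by
      simp at h h0
      linear_combination (2236 * x ^ 3 - 18124 * x ^ 2 - 18642 * x - 9865) / 32847 * h0 - (8944 * x
          ^ 2 - 54608 * x - 36208) / 32847 * h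
  refine ⟨R, hR.trans (by compute_degree!), fun x => by simp [h]⟩

open Polynomial in
lemma exists_sextic_roots : ∃ R : Finset ℂ, R.card = 6 ∧
    ∀ x, x ∈ R ↔ 237 * x ^ 6 - 1088 * x ^ 5 - 4381 * x ^ 4 - 5942 * x ^ 3 - 4683 * x ^ 2 - 2082 * x
        - 321 = 0 := by
  obtain ⟨R, hR, h⟩ := exists_finset_roots
    (P := 237 * X ^ 6 - 1088 * X ^ 5 - 4381 * X ^ 4 - 5942 * X ^ 3 - 4683 * X ^ 2 - 2082 * X - 321)
    fun x h h0 => one_ne_zero (α := ℂ) <| by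
      simp at h h0
      linear_combination (188099097811995499100688 * x ^ 5 - 1009134584430363504981731 * x ^ 4 -
          2680261701263444635002734 * x ^ 3 - 2729244843162860849956434 * x ^ 2 -
          1796119737939766664342160 * x - 431539722316468431886569) / 46305674434751377851336600 *
          h0 - (564297293435986497302064 * x ^ 4 - 2595648862110813926292137 * x ^ 3 -
          4897990778100985958575386 * x ^ 2 - 3511259071546043362840089 * x -
          1327352067645071491178349) / 23152837217375688925668300 * h
  refine ⟨R, hR.trans (by compute_degree!), fun x => by simp [h]⟩

/-- A pair of unordered pairs of distinct numbers has four orderings. -/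
lemma ncard_of_symmetric_coordinates (Q : Finset (ℂ × ℂ × ℂ × ℂ))
    (hQ : ∀ q ∈ Q, q.1 ^ 2 - 4 * q.2.1 ≠ 0 ∧ q.2.2.1 ^ 2 - 4 * q.2.2.2 ≠ 0) :
    {x : Fin 4 → ℂ | (x 0 + x 1, x 0 * x 1, x 2 + x 3, x 2 * x 3) ∈ Q}.ncard = 4 * Q.card := by
  classical
  choose r hr using fun z : ℂ => IsAlgClosed.exists_pow_nat_eq z two_pos
  let E : Finset ℂ := {1, -1}
  have hE : ∀ e, e ∈ E ↔ e = 1 ∨ e = -1 := by simp [E]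
  have hE2 : E.card = 2 := Finset.card_pair (by norm_num)
  let g : (ℂ × ℂ × ℂ × ℂ) × ℂ × ℂ → Fin 4 → ℂ := fun y =>
    ![(y.1.1 + y.2.1 * r (y.1.1 ^ 2 - 4 * y.1.2.1)) / 2,
      (y.1.1 - y.2.1 * r (y.1.1 ^ 2 - 4 * y.1.2.1)) / 2,
      (y.1.2.2.1 + y.2.2 * r (y.1.2.2.1 ^ 2 - 4 * y.1.2.2.2)) / 2,
      (y.1.2.2.1 - y.2.2 * r (y.1.2.2.1 ^ 2 - 4 * y.1.2.2.2)) / 2]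
  have hprod (a b e : ℂ) (he : e ∈ E) :
      (a + e * r (a ^ 2 - 4 * b)) / 2 * ((a - e * r (a ^ 2 - 4 * b)) / 2) = b := by
    have he2 : e ^ 2 = 1 := by
      rcases (hE e).1 he with rfl | rfl <;> norm_num
    linear_combination (-(r (a ^ 2 - 4 * b)) ^ 2 / 4) * he2 - hr (a ^ 2 - 4 * b) / 4
  have hsym (y) (hy : y ∈ Q ×ˢ E ×ˢ E) :
      (g y 0 + g y 1, g y 0 * g y 1, g y 2 + g y 3, g y 2 * g y 3) = y.1 := by
    obtain ⟨⟨t, u, s, p⟩, e, f⟩ := y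
    simp only [Finset.mem_product] at hy
    obtain ⟨-, he, hf⟩ := hy
    refine Prod.ext ?_ (Prod.ext (hprod t u e he) (Prod.ext ?_ (hprod s p f hf)))
    · change (t + e * r (t ^ 2 - 4 * u)) / 2 + (t - e * r (t ^ 2 - 4 * u)) / 2 = t
      ring
    · change (s + f * r (s ^ 2 - 4 * p)) / 2 + (s - f * r (s ^ 2 - 4 * p)) / 2 = s
      ring
  have hr0 (z : ℂ) (hz : z ≠ 0) : r z ≠ 0 := fun h => hz (by rw [← hr z, h]; norm_num)
  have hinj : Set.InjOn g (Q ×ˢ E ×ˢ E : Finset _) := by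
    intro y hy y' hy' h
    have h1 : y.1 = y'.1 := by rw [← hsym y hy, ← hsym y' hy', h]
    obtain ⟨q, e, f⟩ := y
    obtain ⟨q', e', f'⟩ := y'
    obtain rfl : q = q' := h1
    obtain ⟨hq1, hq2⟩ := hQ q (Finset.mem_product.1 hy).1
    have h0 := congrFun h 0
    have h2 := congrFun h 2
    simp only [g, cons_val_zero, cons_val] at h0 h2
    have he : e = e' := mul_right_cancel₀ (hr0 _ hq1) (by linear_combination 2 * h0)
    have hf : f = f' := mul_right_cancel₀ (hr0 _ hq2) (by linear_combination 2 * h2)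
    rw [he, hf]
  have hsign (a b : ℂ) (h : (a + b) ^ 2 - 4 * (a * b) ≠ 0) :
      ∃ e ∈ E, e * r ((a + b) ^ 2 - 4 * (a * b)) = a - b := by
    have : (a - b) ^ 2 = r ((a + b) ^ 2 - 4 * (a * b)) ^ 2 := by rw [hr]; ring
    rcases sq_eq_sq_iff_eq_or_eq_neg.1 this with h | h
    · exact ⟨1, by simp [E], by rw [h, one_mul]⟩
    · exact ⟨-1, by simp [E], by rw [h]; ring⟩
  have himage : {x : Fin 4 → ℂ | (x 0 + x 1, x 0 * x 1, x 2 + x 3, x 2 * x 3) ∈ Q} =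
      ((Q ×ˢ E ×ˢ E).image g : Finset _) := by
    ext x
    simp only [Set.mem_ofPred_eq, Finset.coe_image, Set.mem_image, Finset.mem_coe]
    constructor
    · intro hx
      obtain ⟨hq1, hq2⟩ := hQ _ hx
      obtain ⟨e, he, he'⟩ := hsign _ _ hq1
      obtain ⟨f, hf, hf'⟩ := hsign _ _ hq2
      refine ⟨(_, e, f), Finset.mem_product.2 ⟨hx, Finset.mem_product.2 ⟨he, hf⟩⟩, ?_⟩
      ext i
      fin_cases i <;> simp [g, he', hf']
    · rintro ⟨y, hy, rfl⟩
      rw [hsym y hy]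
      exact (Finset.mem_product.1 hy).1
  rw [himage, Set.ncard_coe_finset, Finset.card_image_of_injOn hinj, Finset.card_product,
    Finset.card_product, hE2]
  ring

/-- The solutions of the system in symmetric coordinates: there are ten, all nondegenerate. -/
lemma exists_finset_remaindersVanish : ∃ Q : Finset (ℂ × ℂ × ℂ × ℂ), Q.card = 10 ∧
    (∀ q, q ∈ Q ↔ RemaindersVanish q.1 q.2.1 q.2.2.1 q.2.2.2) ∧
    ∀ q ∈ Q, q.1 ^ 2 - 4 * q.2.1 ≠ 0 ∧ q.2.2.1 ^ 2 - 4 * q.2.2.2 ≠ 0 ∧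
      jacFactor q.1 q.2.1 q.2.2.1 q.2.2.2 ≠ 0 := by
  classical
  obtain ⟨A, hA, hA'⟩ := exists_quartic_roots
  obtain ⟨B, hB, hB'⟩ := exists_sextic_roots
  let a : ℂ → ℂ × ℂ × ℂ × ℂ := fun x => (quarticT x, 0, x, 0)
  let b : ℂ → ℂ × ℂ × ℂ × ℂ := fun x => (sexticT x, sexticU x, x, sexticP x)
  have ha : a.Injective := fun x y h => congrArg (fun q => q.2.2.1) h
  have hb : b.Injective := fun x y h => congrArg (fun q => q.2.2.1) h
  refine ⟨A.image a ∪ B.image b, ?_, ?_, ?_⟩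
  · rw [Finset.card_union_of_disjoint, Finset.card_image_of_injective _ ha,
      Finset.card_image_of_injective _ hb, hA, hB]
    rw [Finset.disjoint_left]
    simp only [Finset.mem_image]
    rintro _ ⟨x, -, rfl⟩ ⟨y, hy, h⟩
    exact sexticP_ne_zero ((hB' y).1 hy) (congrArg (fun q => q.2.2.2) h)
  · rintro ⟨t, u, s, p⟩
    simp only [Finset.mem_union, Finset.mem_image, a, b, Prod.mk.injEq]
    constructor
    · rintro (⟨x, hx, rfl, rfl, rfl, rfl⟩ | ⟨x, hx, rfl, rfl, rfl, rfl⟩)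
      · exact (remaindersVanish_zero_iff _ _ _).2 ⟨(hA' _).1 hx, rfl, rfl⟩
      · exact remaindersVanish_of_sextic ((hB' _).1 hx)
    · intro h
      by_cases hp : p = 0
      · subst hp
        obtain ⟨hs, ht, hu⟩ := (remaindersVanish_zero_iff _ _ _).1 h
        exact Or.inl ⟨s, (hA' s).2 hs, ht.symm, hu.symm, rfl, rfl⟩
      · obtain ⟨hs, ht, hu, hp⟩ := eq_of_remaindersVanish hp h
        exact Or.inr ⟨s, (hB' s).2 hs, ht.symm, hu.symm, rfl, hp.symm⟩
  · simp only [Finset.mem_union, Finset.mem_image]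
    rintro _ (⟨x, hx, rfl⟩ | ⟨x, hx, rfl⟩)
    · exact nondegenerate_of_quartic ((hA' x).1 hx)
    · exact nondegenerate_of_sextic ((hB' x).1 hx)

/-- For this matrix, `S(M)` has exactly 40 elements and the Jacobian of `F(·; M)` is
invertible at each of them (all 40 solutions are nonsingular). -/
theorem forty_nonsingular_solutions :
    (Ssol (M₁₀.map (fun q => (q : ℂ)))).ncard = 40 ∧
    ∀ x ∈ Ssol (M₁₀.map (fun q => (q : ℂ))),
      IsUnit (Jac (M₁₀.map (fun q => (q : ℂ))) x) := by
  obtain ⟨Q, hcard, hmem, hQ⟩ := exists_finset_remaindersVanish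
  constructor
  · have h : Ssol (M₁₀.map (fun q => (q : ℂ))) =
        {x : Fin 4 → ℂ | (x 0 + x 1, x 0 * x 1, x 2 + x 3, x 2 * x 3) ∈ Q} := by
      ext x
      rw [mem_Ssol_iff, Set.mem_ofPred_eq]
      have hx := hmem (x 0 + x 1, x 0 * x 1, x 2 + x 3, x 2 * x 3)
      refine ⟨fun h => hx.2 h.1, fun h => ⟨hx.1 h, fun h0 => ?_, fun h0 => ?_⟩⟩
      · exact (hQ _ h).1 (by simp only [h0]; ring)
      · exact (hQ _ h).2.1 (by simp only [h0]; ring)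
    rw [h, ncard_of_symmetric_coordinates Q fun q hq => ⟨(hQ q hq).1, (hQ q hq).2.1⟩, hcard]
  · intro x hx
    obtain ⟨h, ht, hs⟩ := (mem_Ssol_iff x).1 hx
    have hq := hQ _ ((hmem (x 0 + x 1, x 0 * x 1, x 2 + x 3, x 2 * x 3)).2 h)
    rw [isUnit_iff_isUnit_det, det_Jac_M₁₀ x h, isUnit_iff_ne_zero]
    exact mul_ne_zero (mul_ne_zero (sub_ne_zero.2 ht) (pow_ne_zero 3 (sub_ne_zero.2 hs)))
      hq.2.2
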